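/- arXiv:1003.3585 — 3 statements merged into one kernel-verified Lean document; each statement's English description precedes it below -/
import Mathlib

section
/- Evolution identity for the weighted mass. Let a, b, c, d, e ∈ ℝ and let u : ℝ × ℝ → ℂ be a smooth function such that for each t the map x ↦ u(x,t) is a Schwartz function (with all estimates locally uniform in t), and suppose u satisfies pointwise the equation ∂_t u + i a ∂_x² u + b ∂_x³ u + i c |u|² u + d |u|² ∂_x u + e u² ∂_x ū = 0 on ℝ². Then for every C³ weight φ : ℝ → ℝ with φ, φ', φ'', φ''' bounded on ℝ, and every t: d/dt ∫_ℝ φ(x) |u(x,t)|² dx = −2a · Im( ∫_ℝ φ'(x) ū ∂_x u dx ) + 3b · Re( ∫_ℝ φ'(x) (∂_x² ū) u dx ) + b · Re( ∫_ℝ φ''(x) (∂_x ū) u dx ) + ((d+e)/2) ∫_ℝ φ'(x) |u|⁴ dx. -/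
open MeasureTheory Complex

/-- The higher order nonlinear Schrödinger (Airy–Schrödinger) equation
`∂ₜu + i a ∂ₓ²u + b ∂ₓ³u + i c |u|²u + d |u|²∂ₓu + e u²∂ₓū = 0`,
for `u : ℝ → ℝ → ℂ`, written as `u x t` (space first, time second). -/
def AirySchrodingerEq (a b c d e : ℝ) (u : ℝ → ℝ → ℂ) : Prop :=
  ∀ x t : ℝ,
    deriv (fun τ => u x τ) t
      + Complex.I * (a : ℂ) * iteratedDeriv 2 (fun y => u y t) x
      + (b : ℂ) * iteratedDeriv 3 (fun y => u y t) x
      + Complex.I * (c : ℂ) * (‖u x t‖ : ℂ) ^ 2 * u x t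
      + (d : ℂ) * (‖u x t‖ : ℂ) ^ 2 * deriv (fun y => u y t) x
      + (e : ℂ) * (u x t) ^ 2 * deriv (fun y => (starRingEnd ℂ) (u y t)) x = 0

private lemma integrable_conj_mul {w : ℝ → ℝ} {f g : ℝ → ℂ}
    (hw : Continuous w) (hwb : ∃ C, ∀ x, |w x| ≤ C)
    (hf : Continuous f) (hfb : ∃ C, ∀ x, ‖f x‖ ≤ C) (hg : Integrable g) :
    Integrable fun x => (w x : ℂ) * (starRingEnd ℂ) (f x) * g x := by
  obtain ⟨A, hA⟩ := hwb
  obtain ⟨B, hB⟩ := hfb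
  refine hg.bdd_mul (c := A * B) (by fun_prop) (Filter.Eventually.of_forall fun x => ?_)
  rw [norm_mul, RCLike.norm_conj, Complex.norm_real, Real.norm_eq_abs]
  exact mul_le_mul (hA x) (hB x) (norm_nonneg _) ((abs_nonneg _).trans (hA x))

/-- The derivative of the weighted flux attached to the Airy–Schrödinger equation, in terms of the
spatial derivatives `v₀, v₁, v₂, v₃` of a solution; `k` stands for `d + e`. -/
private lemma hasDerivAt_flux (a b k : ℝ) {w w₁ w₂ : ℝ → ℝ} {v : ℕ → ℝ → ℂ}
    (hw : ∀ x, HasDerivAt w (w₁ x) x) (hw₁ : ∀ x, HasDerivAt w₁ (w₂ x) x)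
    (hv : ∀ n x, HasDerivAt (v n) (v (n + 1) x) x) (x : ℝ) :
    HasDerivAt (fun x => 2 * a * ((w x : ℂ) * (starRingEnd ℂ) (v 0 x) * v 1 x).im
        - 2 * b * ((w x : ℂ) * (starRingEnd ℂ) (v 0 x) * v 2 x).re
        + b * ((w x : ℂ) * (starRingEnd ℂ) (v 1 x) * v 1 x).re
        - b * ((w₁ x : ℂ) * (starRingEnd ℂ) (v 1 x) * v 0 x).re
        - k / 2 * (w x * ‖v 0 x‖ ^ 4))
      (2 * a * (w x * ((starRingEnd ℂ) (v 0 x) * v 2 x).im)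
        - 2 * b * (w x * ((starRingEnd ℂ) (v 0 x) * v 3 x).re)
        - 2 * k * (w x * ‖v 0 x‖ ^ 2 * ((starRingEnd ℂ) (v 0 x) * v 1 x).re)
        - (-2 * a * ((w₁ x : ℂ) * (starRingEnd ℂ) (v 0 x) * v 1 x).im
          + 3 * b * ((w₁ x : ℂ) * (starRingEnd ℂ) (v 2 x) * v 0 x).re
          + b * ((w₂ x : ℂ) * (starRingEnd ℂ) (v 1 x) * v 0 x).re
          + k / 2 * (w₁ x * ‖v 0 x‖ ^ 4))) x := by
  have hre : ∀ n, HasDerivAt (fun x => (v n x).re) (v (n + 1) x).re x := fun n =>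
    Complex.reCLM.hasFDerivAt.comp_hasDerivAt x (hv n x)
  have him : ∀ n, HasDerivAt (fun x => (v n x).im) (v (n + 1) x).im x := fun n =>
    Complex.imCLM.hasFDerivAt.comp_hasDerivAt x (hv n x)
  have h4 : ∀ z : ℂ, ‖z‖ ^ 4 = (z.re * z.re + z.im * z.im) ^ 2 := fun z => by
    rw [← Complex.normSq_apply, ← Complex.sq_norm]; ring
  have h2 : ∀ z : ℂ, ‖z‖ ^ 2 = z.re * z.re + z.im * z.im := fun z => by
    rw [← Complex.normSq_apply, ← Complex.sq_norm]
  simp only [h4, h2, Complex.mul_re, Complex.mul_im, Complex.conj_re, Complex.conj_im,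
    Complex.ofReal_re, Complex.ofReal_im, zero_mul, sub_zero, add_zero]
  have p0 := hre 0
  have p1 := hre 1
  have p2 := hre 2
  have q0 := him 0
  have q1 := him 1
  have q2 := him 2
  have hA := ((hw x).mul p0).mul q1
  have hB := ((hw x).mul q0).mul p1
  have hC := ((hw x).mul p0).mul p2
  have hD := ((hw x).mul q0).mul q2
  have hE := ((hw x).mul p1).mul p1
  have hF := ((hw x).mul q1).mul q1
  have hG := ((hw₁ x).mul p1).mul p0
  have hH := ((hw₁ x).mul q1).mul q0
  have hI := (hw x).mul (((p0.mul p0).add (q0.mul q0)).pow 2)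
  have hall := (((((hA.sub hB).const_mul (2 * a)).sub ((hC.add hD).const_mul (2 * b))).add
    ((hE.add hF).const_mul b)).sub ((hG.add hH).const_mul b)).sub (hI.const_mul (k / 2))
  refine (hall.congr_of_eventuallyEq (Filter.Eventually.of_forall fun y => ?_)).congr_deriv ?_
  · simp only [Pi.mul_apply, Pi.add_apply, Pi.sub_apply, Pi.pow_apply]
    ring
  · simp only [Pi.mul_apply, Pi.add_apply, Pi.pow_apply]
    norm_num
    ring

private lemma norm_le_mul_inv_one_add_sq {z : ℂ} {r A B : ℝ}
    (h0 : |r| ^ 0 * ‖z‖ ≤ A) (h2 : |r| ^ 2 * ‖z‖ ≤ B) :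
    ‖z‖ ≤ (A + B) * (1 + r ^ 2)⁻¹ := by
  rw [← div_eq_mul_inv, le_div_iff₀ (by positivity)]
  rw [sq_abs] at h2
  rw [pow_zero, one_mul] at h0
  linarith

/-- evolution identity for the weighted mass, core of Proposition 3.2.
For a smooth solution `u`, Schwartz in `x` locally uniformly in `t`, and a `C³` weight
`φ` with bounded derivatives up to order three,
`d/dt ∫ φ|u|² = −2a Im ∫ φ' ū ∂ₓu + 3b Re ∫ φ' (∂ₓ²ū) u + b Re ∫ φ'' (∂ₓū) u
  + ((d+e)/2) ∫ φ' |u|⁴`. -/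
theorem weighted_mass_evolution (a b c d e : ℝ) (u : ℝ → ℝ → ℂ)
    (hsmooth : ContDiff ℝ (⊤ : ℕ∞) (fun p : ℝ × ℝ => u p.1 p.2))
    (hdecay : ∀ (k n : ℕ) (T : ℝ), 0 < T → ∃ C, ∀ x t : ℝ, |t| ≤ T →
      |x| ^ k * ‖iteratedDeriv n (fun y => u y t) x‖ ≤ C)
    (heq : AirySchrodingerEq a b c d e u)
    (φ : ℝ → ℝ) (hφ : ContDiff ℝ 3 φ)
    (hb0 : ∃ C, ∀ x, |φ x| ≤ C) (hb1 : ∃ C, ∀ x, |deriv φ x| ≤ C)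
    (hb2 : ∃ C, ∀ x, |iteratedDeriv 2 φ x| ≤ C)
    (hb3 : ∃ C, ∀ x, |iteratedDeriv 3 φ x| ≤ C) (t : ℝ) :
    HasDerivAt (fun τ : ℝ => ∫ x : ℝ, φ x * ‖u x τ‖ ^ 2)
      (-2 * a * (∫ x : ℝ, ((deriv φ x : ℝ) : ℂ) * (starRingEnd ℂ) (u x t) *
          deriv (fun y => u y t) x).im
        + 3 * b * (∫ x : ℝ, ((deriv φ x : ℝ) : ℂ) *
            (starRingEnd ℂ) (iteratedDeriv 2 (fun y => u y t) x) * u x t).re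
        + b * (∫ x : ℝ, ((iteratedDeriv 2 φ x : ℝ) : ℂ) *
            (starRingEnd ℂ) (deriv (fun y => u y t) x) * u x t).re
        + ((d + e) / 2) * ∫ x : ℝ, deriv φ x * ‖u x t‖ ^ 4) t := by
  let v : ℕ → ℝ → ℝ → ℂ := fun n τ x => iteratedDeriv n (fun y => u y τ) x
  have hv_zero : ∀ τ x, v 0 τ x = u x τ := fun τ x => by simp [v]
  have hv_one : ∀ τ x, v 1 τ x = deriv (fun y => u y τ) x := fun τ x => by
    simp [v, iteratedDeriv_one]
  have hx : ∀ τ, ContDiff ℝ (⊤ : ℕ∞) (fun y => u y τ) := fun τ =>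
    hsmooth.comp (contDiff_id.prodMk contDiff_const)
  have ht : ∀ x, ContDiff ℝ (⊤ : ℕ∞) (fun τ => u x τ) := fun x =>
    hsmooth.comp (contDiff_const.prodMk contDiff_id)
  have hvd : ∀ τ n x, HasDerivAt (v n τ) (v (n + 1) τ x) x := fun τ n x => by
    have := ((hx τ).differentiable_iteratedDeriv n
      (by exact_mod_cast ENat.natCast_lt_top n)).differentiableAt (x := x) |>.hasDerivAt
    simpa only [v, iteratedDeriv_succ] using this
  have hvc : ∀ τ n, Continuous (v n τ) := fun τ n =>
    continuous_iff_continuousAt.2 fun x => (hvd τ n x).continuousAt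
  -- uniform bounds on a time window around `t`
  have hT : 0 < |t| + 1 := by positivity
  have hbd : ∀ n, ∃ C, ∀ x τ, |τ| ≤ |t| + 1 → ‖v n τ x‖ ≤ C := fun n => by
    obtain ⟨C, hC⟩ := hdecay 0 n _ hT
    exact ⟨C, fun x τ h => by simpa using hC x τ h⟩
  have hdec : ∀ n, ∃ C, ∀ x τ, |τ| ≤ |t| + 1 → ‖v n τ x‖ ≤ C * (1 + x ^ 2)⁻¹ := fun n => by
    obtain ⟨A, hA⟩ := hdecay 0 n _ hT
    obtain ⟨B, hB⟩ := hdecay 2 n _ hT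
    exact ⟨A + B, fun x τ h => norm_le_mul_inv_one_add_sq (hA x τ h) (hB x τ h)⟩
  have hwin : ∀ τ ∈ Metric.ball t 1, |τ| ≤ |t| + 1 := fun τ h => by
    rw [Metric.mem_ball, Real.dist_eq] at h
    have := abs_sub_abs_le_abs_sub τ t
    linarith
  have ht_mem : |t| ≤ |t| + 1 := by linarith
  have hvb : ∀ n, ∃ C, ∀ x, ‖v n t x‖ ≤ C := fun n =>
    (hbd n).imp fun C hC x => hC x t ht_mem
  have hvi : ∀ n, Integrable (v n t) := fun n => by
    obtain ⟨C, hC⟩ := hdec n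
    exact (integrable_inv_one_add_sq.const_mul C).mono' (hvc t n).aestronglyMeasurable
      (Filter.Eventually.of_forall fun x => hC x t ht_mem)
  -- the weight
  have hφ0 : Continuous φ := hφ.continuous
  have hφd : ∀ x, HasDerivAt φ (deriv φ x) x := fun x =>
    (hφ.differentiable (by norm_num) x).hasDerivAt
  have hφ1d : ∀ x, HasDerivAt (deriv φ) (iteratedDeriv 2 φ x) x := fun x => by
    have := (hφ.differentiable_iteratedDeriv 1 (by norm_num) x).hasDerivAt
    rw [← iteratedDeriv_succ] at this
    rwa [iteratedDeriv_one] at this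
  have hφ1 : Continuous (deriv φ) :=
    continuous_iff_continuousAt.2 fun x => (hφ1d x).continuousAt
  have hφ2 : Continuous (iteratedDeriv 2 φ) := hφ.continuous_iteratedDeriv 2 (by norm_num)
  -- the time derivative, expressed through the equation
  let N : ℝ → ℝ → ℂ := fun τ x =>
    -(I * a * v 2 τ x + b * v 3 τ x + I * c * (‖v 0 τ x‖ : ℂ) ^ 2 * v 0 τ x
      + d * (‖v 0 τ x‖ : ℂ) ^ 2 * v 1 τ x + e * v 0 τ x ^ 2 * (starRingEnd ℂ) (v 1 τ x))
  have hN : ∀ x τ, HasDerivAt (fun τ => u x τ) (N τ x) τ := fun x τ => by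
    have h := ((ht x).differentiable (by simp) τ).hasDerivAt
    have hconj : deriv (fun y => (starRingEnd ℂ) (u y τ)) x = (starRingEnd ℂ) (v 1 τ x) := by
      have := (hvd τ 0 x).star
      simp only [hv_zero] at this
      simpa using this.deriv
    have := heq x τ
    rw [hconj] at this
    refine h.congr_deriv ?_
    simp only [N, hv_zero]
    rw [hv_one] at this ⊢
    linear_combination this
  have hNc : ∀ τ, Continuous (N τ) := fun τ => by
    have h0 := hvc τ 0
    have h1 := hvc τ 1
    have h2 := hvc τ 2
    have h3 := hvc τ 3
    have hc := Complex.continuous_conj.comp h1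
    simp only [N]
    fun_prop
  obtain ⟨K, hK⟩ : ∃ K, ∀ x τ, |τ| ≤ |t| + 1 → ‖N τ x‖ ≤ K := by
    obtain ⟨C0, h0⟩ := hbd 0
    obtain ⟨C1, h1⟩ := hbd 1
    obtain ⟨C2, h2⟩ := hbd 2
    obtain ⟨C3, h3⟩ := hbd 3
    refine ⟨|a| * C2 + |b| * C3 + |c| * C0 ^ 2 * C0 + |d| * C0 ^ 2 * C1 + |e| * C0 ^ 2 * C1,
      fun x τ h => ?_⟩
    have h0 := h0 x τ h
    have h1 := h1 x τ h
    have h2 := h2 x τ h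
    have h3 := h3 x τ h
    have hC0 : 0 ≤ C0 := (norm_nonneg _).trans h0
    simp only [N, norm_neg]
    refine norm_add_le_of_le (norm_add_le_of_le (norm_add_le_of_le
      (norm_add_le_of_le ?_ ?_) ?_) ?_) ?_ <;>
    · simp only [norm_mul, norm_pow, Complex.norm_I, Complex.norm_real, Real.norm_eq_abs,
        abs_norm, one_mul, RCLike.norm_conj]
      gcongr
  obtain ⟨A, hA⟩ := hb0
  obtain ⟨B, hB⟩ := hdec 0
  have hA0 : 0 ≤ A := (abs_nonneg _).trans (hA 0)
  have hmain := hasDerivAt_integral_of_dominated_loc_of_deriv_le (μ := volume)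
    (F := fun τ x => φ x * ‖u x τ‖ ^ 2)
    (F' := fun τ x => φ x * (2 * ((starRingEnd ℂ) (v 0 τ x) * N τ x).re))
    (x₀ := t) (s := Metric.ball t 1) (bound := fun x => A * (2 * (B * K)) * (1 + x ^ 2)⁻¹)
    (Metric.ball_mem_nhds t one_pos)
    (Filter.Eventually.of_forall fun τ => by
      have := (hx τ).continuous
      exact Continuous.aestronglyMeasurable (by fun_prop))
    (by
      have := (integrable_conj_mul hφ0 ⟨A, hA⟩ (hvc t 0) (hvb 0) (hvi 0)).re
      refine this.congr (Filter.Eventually.of_forall fun x => ?_)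
      simp only [hv_zero, mul_assoc, Complex.conj_mul']
      norm_cast)
    (by
      have h0 := Complex.continuous_conj.comp (hvc t 0)
      have h1 := hNc t
      have h2 := Complex.continuous_re.comp (h0.mul h1)
      exact (hφ0.mul (continuous_const.mul h2)).aestronglyMeasurable)
    (Filter.Eventually.of_forall fun x τ hτ => by
      have hB := hB x τ (hwin τ hτ)
      have hK := hK x τ (hwin τ hτ)
      have h1 : |((starRingEnd ℂ) (v 0 τ x) * N τ x).re| ≤ B * (1 + x ^ 2)⁻¹ * K := by
        refine (Complex.abs_re_le_norm _).trans ?_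
        rw [norm_mul, RCLike.norm_conj]
        exact mul_le_mul hB hK (norm_nonneg _) ((norm_nonneg _).trans hB)
      rw [Real.norm_eq_abs, abs_mul, abs_mul, abs_two]
      calc _ ≤ A * (2 * (B * (1 + x ^ 2)⁻¹ * K)) := by
            have := hA x
            gcongr
        _ = _ := by ring)
    (integrable_inv_one_add_sq.const_mul _)
    (Filter.Eventually.of_forall fun x τ _ => by
      have := (hN x τ).norm_sq.const_mul (φ x)
      refine this.congr_deriv ?_
      rw [hv_zero, Complex.inner, mul_comm ((starRingEnd ℂ) _)])
  refine hmain.2.congr_deriv ?_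
  -- integrate the flux identity
  have hi01 := (integrable_conj_mul hφ1 hb1 (hvc t 0) (hvb 0) (hvi 1))
  have hi20 := (integrable_conj_mul hφ1 hb1 (hvc t 2) (hvb 2) (hvi 0))
  have hi10 := (integrable_conj_mul hφ2 hb2 (hvc t 1) (hvb 1) (hvi 0))
  have hquart : ∀ {w : ℝ → ℝ}, Continuous w → (∃ C, ∀ x, |w x| ≤ C) →
      Integrable fun x => w x * ‖v 0 t x‖ ^ 4 := fun {w} hw hwb => by
    obtain ⟨C, hC⟩ := hwb
    obtain ⟨D, hD⟩ := hvb 0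
    have hcv := hvc t 0
    have := (hvi 0).norm.bdd_mul (f := fun x => w x * ‖v 0 t x‖ ^ 3) (c := C * D ^ 3)
      (Continuous.aestronglyMeasurable (by fun_prop)) (Filter.Eventually.of_forall fun x => by
        have h1 := hC x
        have h2 := hD x
        have h3 := (abs_nonneg _).trans h1
        rw [norm_mul, norm_pow, norm_norm, Real.norm_eq_abs]
        gcongr)
    refine this.congr (Filter.Eventually.of_forall fun x => ?_)
    ring
  have hR := ((((hi01.im.const_mul (-2 * a)).add (hi20.re.const_mul (3 * b))).add
    (hi10.re.const_mul b)).add ((hquart hφ1 hb1).const_mul ((d + e) / 2)))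
  have hflux := hasDerivAt_flux a b (d + e) hφd hφ1d (hvd t)
  have hG := (((((integrable_conj_mul hφ0 ⟨A, hA⟩ (hvc t 0) (hvb 0) (hvi 1)).im.const_mul
    (2 * a)).sub ((integrable_conj_mul hφ0 ⟨A, hA⟩ (hvc t 0) (hvb 0) (hvi 2)).re.const_mul
    (2 * b))).add ((integrable_conj_mul hφ0 ⟨A, hA⟩ (hvc t 1) (hvb 1) (hvi 1)).re.const_mul
    b)).sub ((integrable_conj_mul hφ1 hb1 (hvc t 1) (hvb 1) (hvi 0)).re.const_mul b)).sub
    ((hquart hφ0 ⟨A, hA⟩).const_mul ((d + e) / 2))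
  have hpt : ∀ x, φ x * (2 * ((starRingEnd ℂ) (v 0 t x) * N t x).re)
      = 2 * a * (φ x * ((starRingEnd ℂ) (v 0 t x) * v 2 t x).im)
        - 2 * b * (φ x * ((starRingEnd ℂ) (v 0 t x) * v 3 t x).re)
        - 2 * (d + e) * (φ x * ‖v 0 t x‖ ^ 2 * ((starRingEnd ℂ) (v 0 t x) * v 1 t x).re) := by
    intro x
    have h2 : ‖v 0 t x‖ ^ 2 = (v 0 t x).re * (v 0 t x).re + (v 0 t x).im * (v 0 t x).im := by
      rw [← Complex.normSq_apply, ← Complex.sq_norm]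
    simp only [N, ← Complex.ofReal_pow, h2]
    simp [pow_two]
    ring
  have hzero := integral_eq_zero_of_hasDerivAt_of_integrable hflux
    ((hmain.1.sub hR).congr (Filter.Eventually.of_forall fun x => by
      simp only [Pi.sub_apply, Pi.add_apply, hpt]
      rfl)) hG
  simp_rw [← hpt] at hzero
  have him : ∫ x, (((deriv φ x : ℝ) : ℂ) * (starRingEnd ℂ) (v 0 t x) * v 1 t x).im
      = (∫ x, ((deriv φ x : ℝ) : ℂ) * (starRingEnd ℂ) (v 0 t x) * v 1 t x).im :=
    integral_im hi01
  have hre : ∫ x, (((deriv φ x : ℝ) : ℂ) * (starRingEnd ℂ) (v 2 t x) * v 0 t x).re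
      = (∫ x, ((deriv φ x : ℝ) : ℂ) * (starRingEnd ℂ) (v 2 t x) * v 0 t x).re :=
    integral_re hi20
  have hre' : ∫ x, (((iteratedDeriv 2 φ x : ℝ) : ℂ) * (starRingEnd ℂ) (v 1 t x) * v 0 t x).re
      = (∫ x, ((iteratedDeriv 2 φ x : ℝ) : ℂ) * (starRingEnd ℂ) (v 1 t x) * v 0 t x).re :=
    integral_re hi10
  refine (sub_eq_zero.1 ((integral_sub hmain.1 hR).symm.trans hzero)).trans ?_
  rw [integral_add' (((hi01.im.const_mul _).add (hi20.re.const_mul _)).add (hi10.re.const_mul _))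
      ((hquart hφ1 hb1).const_mul _),
    integral_add' ((hi01.im.const_mul _).add (hi20.re.const_mul _)) (hi10.re.const_mul _),
    integral_add' (hi01.im.const_mul _) (hi20.re.const_mul _)]
  simp only [integral_const_mul, RCLike.im_eq_complex_im, RCLike.re_eq_complex_re, him, hre, hre']
  simp only [hv_zero, hv_one]
  rfl
end

section
/- Weighted a priori estimate (Proposition 3.2 for classical solutions). Let a, b, c, d, e ∈ ℝ, T > 0, and let u : ℝ × [−T,T] → ℂ be a smooth function, Schwartz in x for each t, satisfying pointwise ∂_t u + i a ∂_x² u + b ∂_x³ u + i c |u|² u + d |u|² ∂_x u + e u² ∂_x ū = 0. Set a₀ = 2|a| + 3|b| + |d+e|/2 and A = ‖u(·,0)‖²_{L²} + (1 + ‖u(·,0)‖⁴_{L²}) · sup_{t∈[−T,T]} ‖∂_x u(·,t)‖²_{L²} + sup_{t∈[−T,T]} ‖∂_x² u(·,t)‖²_{L²}, assumed finite. Then for every t ∈ [−T,T]: ∫_ℝ x² |u(x,t)|² dx ≤ e^{a₀ T} ( ∫_ℝ x² |u(x,0)|² dx + a₀ T A ). -/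
open MeasureTheory Complex

/-- The higher order nonlinear Schrödinger (Airy–Schrödinger) equation at a point. -/
def airyEqAt (a b c d e : ℝ) (u : ℝ → ℝ → ℂ) (x t : ℝ) : Prop :=
  deriv (fun τ => u x τ) t
    + Complex.I * (a : ℂ) * iteratedDeriv 2 (fun y => u y t) x
    + (b : ℂ) * iteratedDeriv 3 (fun y => u y t) x
    + Complex.I * (c : ℂ) * (‖u x t‖ : ℂ) ^ 2 * u x t
    + (d : ℂ) * (‖u x t‖ : ℂ) ^ 2 * deriv (fun y => u y t) x
    + (e : ℂ) * (u x t) ^ 2 * deriv (fun y => (starRingEnd ℂ) (u y t)) x = 0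

/-- The family `x ↦ f x t`, `t ∈ s`, is continuous and decays faster than every power of `x`,
uniformly in `t ∈ s`. -/
def RapidOn (s : Set ℝ) (f : ℝ → ℝ → ℝ) : Prop :=
  (∀ t ∈ s, Continuous fun x => f x t) ∧
    ∀ k : ℕ, ∃ C, ∀ x, ∀ t ∈ s, |x| ^ k * |f x t| ≤ C

namespace RapidOn

variable {s : Set ℝ} {f g : ℝ → ℝ → ℝ}

theorem add (hf : RapidOn s f) (hg : RapidOn s g) : RapidOn s fun x t => f x t + g x t := by
  refine ⟨fun t ht => (hf.1 t ht).add (hg.1 t ht), fun k => ?_⟩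
  obtain ⟨C, hC⟩ := hf.2 k
  obtain ⟨D, hD⟩ := hg.2 k
  refine ⟨C + D, fun x t ht => ?_⟩
  calc |x| ^ k * |f x t + g x t| ≤ |x| ^ k * (|f x t| + |g x t|) := by
        gcongr; exact abs_add_le _ _
    _ ≤ C + D := by rw [mul_add]; exact add_le_add (hC x t ht) (hD x t ht)

theorem mul (hf : RapidOn s f) (hg : RapidOn s g) : RapidOn s fun x t => f x t * g x t := by
  refine ⟨fun t ht => (hf.1 t ht).mul (hg.1 t ht), fun k => ?_⟩
  obtain ⟨C, hC⟩ := hf.2 k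
  obtain ⟨D, hD⟩ := hg.2 0
  refine ⟨C * D, fun x t ht => ?_⟩
  have h₁ := hC x t ht
  have h₂ := hD x t ht
  rw [pow_zero, one_mul] at h₂
  rw [abs_mul, ← mul_assoc]
  exact mul_le_mul h₁ h₂ (abs_nonneg _) ((by positivity : 0 ≤ |x| ^ k * |f x t|).trans h₁)

theorem const_mul (c : ℝ) (hf : RapidOn s f) : RapidOn s fun x t => c * f x t := by
  refine ⟨fun t ht => (hf.1 t ht).const_mul c, fun k => ?_⟩
  obtain ⟨C, hC⟩ := hf.2 k
  refine ⟨|c| * C, fun x t ht => ?_⟩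
  rw [abs_mul, mul_left_comm]
  exact mul_le_mul_of_nonneg_left (hC x t ht) (abs_nonneg c)

theorem sub (hf : RapidOn s f) (hg : RapidOn s g) : RapidOn s fun x t => f x t - g x t := by
  simpa [sub_eq_add_neg] using hf.add (hg.const_mul (-1))

theorem pow_mul (m : ℕ) (hf : RapidOn s f) : RapidOn s fun x t => x ^ m * f x t := by
  refine ⟨fun t ht => (continuous_pow m).mul (hf.1 t ht), fun k => ?_⟩
  obtain ⟨C, hC⟩ := hf.2 (k + m)
  refine ⟨C, fun x t ht => ?_⟩
  rw [abs_mul, abs_pow, ← mul_assoc, ← pow_add]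
  exact hC x t ht

theorem id_mul (hf : RapidOn s f) : RapidOn s fun x t => x * f x t := by
  simpa using hf.pow_mul 1

theorem exists_bound (hf : RapidOn s f) :
    ∃ C, ∀ t ∈ s, ∀ x, ‖f x t‖ ≤ C * (1 + x ^ 2)⁻¹ := by
  obtain ⟨C, hC⟩ := hf.2 0
  obtain ⟨D, hD⟩ := hf.2 2
  refine ⟨C + D, fun t ht x => ?_⟩
  have h₁ := hC x t ht
  have h₂ := hD x t ht
  rw [sq_abs] at h₂
  rw [← div_eq_mul_inv, le_div_iff₀ (by positivity), Real.norm_eq_abs]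
  linarith

theorem integrable (hf : RapidOn s f) {t : ℝ} (ht : t ∈ s) : Integrable fun x => f x t := by
  obtain ⟨C, hC⟩ := hf.exists_bound
  exact (integrable_inv_one_add_sq.const_mul C).mono' (hf.1 t ht).aestronglyMeasurable
    (.of_forall (hC t ht))

theorem continuousOn_integral (hf : RapidOn s f)
    (hcont : ∀ x, ContinuousOn (fun t => f x t) s) :
    ContinuousOn (fun t => ∫ x, f x t) s := by
  obtain ⟨C, hC⟩ := hf.exists_bound
  exact continuousOn_of_dominated (fun t ht => (hf.1 t ht).aestronglyMeasurable)
    (fun t ht => .of_forall (hC t ht)) (integrable_inv_one_add_sq.const_mul C) (.of_forall hcont)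

theorem hasDerivAt_integral (hf : RapidOn s f) (hg : RapidOn s g) {t : ℝ} (ht : s ∈ nhds t)
    (hfg : ∀ x, ∀ τ ∈ s, HasDerivAt (fun τ => f x τ) (g x τ) τ) :
    HasDerivAt (fun τ => ∫ x, f x τ) (∫ x, g x t) t := by
  obtain ⟨C, hC⟩ := hg.exists_bound
  have hts := mem_of_mem_nhds ht
  refine (hasDerivAt_integral_of_dominated_loc_of_deriv_le (F := fun τ x => f x τ)
    (F' := fun τ x => g x τ) ht ?_ (hf.integrable hts) (hg.1 t hts).aestronglyMeasurable
    (.of_forall fun x τ hτ => hC τ hτ x) (integrable_inv_one_add_sq.const_mul C)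
    (.of_forall hfg)).2
  filter_upwards [ht] with τ hτ using (hf.1 τ hτ).aestronglyMeasurable

theorem integral_deriv_eq_zero (hf : RapidOn s f) (hg : RapidOn s g) {t : ℝ} (ht : t ∈ s)
    (hfg : ∀ x, HasDerivAt (fun y => f y t) (g x t) x) : ∫ x, g x t = 0 :=
  integral_eq_zero_of_hasDerivAt_of_integrable hfg (hg.integrable ht) (hf.integrable ht)

end RapidOn

/-- An integrable primitive is bounded by half of the integral of a majorant of its derivative. -/
theorem two_mul_le_integral_of_abs_deriv_le {F F' B : ℝ → ℝ} (hF : Integrable F)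
    (hF' : Integrable F') (hB : Integrable B) (hderiv : ∀ x, HasDerivAt F (F' x) x)
    (hle : ∀ x, |F' x| ≤ B x) (x : ℝ) : 2 * F x ≤ ∫ y, B y := by
  have hbot := tendsto_zero_of_hasDerivAt_of_integrableOn_Iic (a := x)
    (fun y _ => hderiv y) hF'.integrableOn hF.integrableOn
  have htop := tendsto_zero_of_hasDerivAt_of_integrableOn_Ioi (a := x)
    (fun y _ => hderiv y) hF'.integrableOn hF.integrableOn
  have h₁ := integral_Iic_of_hasDerivAt_of_tendsto' (a := x) (fun y _ => hderiv y)
    hF'.integrableOn hbot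
  have h₂ := integral_Ioi_of_hasDerivAt_of_tendsto' (a := x) (fun y _ => hderiv y)
    hF'.integrableOn htop
  have h₃ : ∫ y in Set.Iic x, F' y ≤ ∫ y in Set.Iic x, B y :=
    integral_mono hF'.integrableOn hB.integrableOn fun y => (le_abs_self _).trans (hle y)
  have h₄ : ∫ y in Set.Ioi x, -F' y ≤ ∫ y in Set.Ioi x, B y :=
    integral_mono hF'.neg.integrableOn hB.integrableOn fun y => (neg_le_abs _).trans (hle y)
  rw [integral_neg] at h₄
  have h₅ := intervalIntegral.integral_Iic_add_Ioi (b := x) (f := B) (μ := volume)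
    hB.integrableOn hB.integrableOn
  linarith

/-- The one-dimensional Agmon inequality `‖u‖∞² ≤ ‖u‖₂ ‖u'‖₂`, squared, for `u = p + i q`. -/
theorem sq_add_sq_sq_le_integral_mul_integral {s : Set ℝ} {p q p' q' : ℝ → ℝ → ℝ}
    (hp : RapidOn s p) (hq : RapidOn s q) (hp' : RapidOn s p') (hq' : RapidOn s q')
    {t : ℝ} (ht : t ∈ s) (hpd : ∀ x, HasDerivAt (fun y => p y t) (p' x t) x)
    (hqd : ∀ x, HasDerivAt (fun y => q y t) (q' x t) x) (x : ℝ) :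
    (p x t ^ 2 + q x t ^ 2) ^ 2 ≤
      (∫ y, (p y t ^ 2 + q y t ^ 2)) * ∫ y, (p' y t ^ 2 + q' y t ^ 2) := by
  have hN : RapidOn s fun x t => p x t ^ 2 + q x t ^ 2 := by
    simpa only [sq] using (hp.mul hp).add (hq.mul hq)
  have hK : RapidOn s fun x t => p' x t ^ 2 + q' x t ^ 2 := by
    simpa only [sq] using (hp'.mul hp').add (hq'.mul hq')
  have hP := ((hp.mul hp').add (hq.mul hq')).const_mul 2
  have hquad (r : ℝ) : 0 ≤ (∫ y, (p y t ^ 2 + q y t ^ 2)) * (r * r) +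
      (-2 * (p x t ^ 2 + q x t ^ 2)) * r + ∫ y, (p' y t ^ 2 + q' y t ^ 2) := by
    have h := two_mul_le_integral_of_abs_deriv_le ((hN.const_mul r).integrable ht)
      ((hP.const_mul r).integrable ht)
      (((hN.const_mul (r * r)).add hK).integrable ht)
      (fun y => (((hpd y).pow 2).add ((hqd y).pow 2)).const_mul r |>.congr_deriv
        (by push_cast; ring))
      (fun y => abs_le.2 ⟨by
        nlinarith [sq_nonneg (r * p y t + p' y t), sq_nonneg (r * q y t + q' y t)], by
        nlinarith [sq_nonneg (r * p y t - p' y t), sq_nonneg (r * q y t - q' y t)]⟩) x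
    rw [integral_add ((hN.const_mul _).integrable ht) (hK.integrable ht),
      integral_const_mul] at h
    linarith
  have h := discrim_le_zero hquad
  rw [discrim] at h
  linarith

/-- Gronwall's inequality for `W' ≤ r (W + A)` with the cruder growth term `r T A`. -/
theorem le_exp_mul_of_deriv_le {W W' : ℝ → ℝ} {r A T : ℝ} (hr : 0 ≤ r) (hA : 0 ≤ A)
    (hcont : ContinuousOn W (Set.Icc 0 T))
    (hderiv : ∀ t ∈ Set.Ioo 0 T, HasDerivAt W (W' t) t)
    (hle : ∀ t ∈ Set.Ioo 0 T, W' t ≤ r * (W t + A)) (hW : 0 ≤ W 0) {t : ℝ}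
    (ht : t ∈ Set.Icc 0 T) : W t ≤ Real.exp (r * T) * (W 0 + r * T * A) := by
  have hd (τ : ℝ) (hτ : τ ∈ Set.Ioo 0 T) :
      HasDerivAt (fun τ => Real.exp (-r * τ) * (W τ + A))
        (Real.exp (-r * τ) * (W' τ - r * (W τ + A))) τ :=
    ((((hasDerivAt_id τ).const_mul (-r)).exp).mul ((hderiv τ hτ).add_const A)).congr_deriv
      (by simp only [id]; ring)
  have hanti : AntitoneOn (fun τ => Real.exp (-r * τ) * (W τ + A)) (Set.Icc 0 T) := by
    refine antitoneOn_of_deriv_nonpos (convex_Icc 0 T)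
      (ContinuousOn.mul (by fun_prop) (hcont.add continuousOn_const)) ?_ ?_ <;>
      rw [interior_Icc]
    · exact fun τ hτ => (hd τ hτ).differentiableAt.differentiableWithinAt
    · intro τ hτ
      rw [(hd τ hτ).deriv]
      exact mul_nonpos_of_nonneg_of_nonpos (Real.exp_pos _).le (by linarith [hle τ hτ])
  have hT : 0 ≤ T := ht.1.trans ht.2
  have h₁ := hanti ⟨le_rfl, hT⟩ ht ht.1
  simp only [mul_zero, Real.exp_zero, one_mul] at h₁
  have h₂ : W t + A ≤ Real.exp (r * t) * (W 0 + A) := by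
    calc W t + A = Real.exp (r * t) * (Real.exp (-r * t) * (W t + A)) := by
          rw [← mul_assoc, ← Real.exp_add]; simp
      _ ≤ _ := by gcongr
  have h₃ : Real.exp (r * t) * (W 0 + A) ≤ Real.exp (r * T) * (W 0 + A) := by
    gcongr; exact ht.2
  have h₄ : Real.exp (r * T) * (1 - r * T) ≤ 1 := by
    calc Real.exp (r * T) * (1 - r * T) ≤ Real.exp (r * T) * Real.exp (-(r * T)) := by
          gcongr; linarith [Real.add_one_le_exp (-(r * T))]
      _ = 1 := by rw [← Real.exp_add]; simp
  nlinarith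

/-- Two-sided version of `le_exp_mul_of_deriv_le`. -/
theorem le_exp_mul_of_abs_deriv_le {W W' : ℝ → ℝ} {r A T : ℝ} (hr : 0 ≤ r) (hA : 0 ≤ A)
    (hcont : ContinuousOn W (Set.Icc (-T) T))
    (hderiv : ∀ t ∈ Set.Ioo (-T) T, HasDerivAt W (W' t) t)
    (hle : ∀ t ∈ Set.Ioo (-T) T, |W' t| ≤ r * (W t + A)) (hW : 0 ≤ W 0) {t : ℝ}
    (ht : t ∈ Set.Icc (-T) T) : W t ≤ Real.exp (r * T) * (W 0 + r * T * A) := by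
  obtain ⟨ht₁, ht₂⟩ := ht
  rcases le_total 0 t with h | h
  · have hmem {τ : ℝ} (hτ : τ ∈ Set.Ioo 0 T) : τ ∈ Set.Ioo (-T) T :=
      ⟨by linarith [hτ.1, hτ.2], hτ.2⟩
    exact le_exp_mul_of_deriv_le hr hA
      (hcont.mono (Set.Icc_subset_Icc_left (by linarith)))
      (fun τ hτ => hderiv τ (hmem hτ))
      (fun τ hτ => (le_abs_self _).trans (hle τ (hmem hτ))) hW ⟨h, ht₂⟩
  · have hmem {τ : ℝ} (hτ : τ ∈ Set.Ioo 0 T) : -τ ∈ Set.Ioo (-T) T :=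
      ⟨by linarith [hτ.1, hτ.2], by linarith [hτ.1, hτ.2]⟩
    have := le_exp_mul_of_deriv_le (W := fun τ => W (-τ)) (W' := fun τ => -W' (-τ)) (t := -t)
      (T := T) hr hA
      (hcont.comp continuousOn_neg fun τ hτ => ⟨by linarith [hτ.2], by linarith [hτ.1, hτ.2]⟩)
      (fun τ hτ => ((hderiv (-τ) (hmem hτ)).comp τ (hasDerivAt_neg τ)).congr_deriv (by ring))
      (fun τ hτ => (neg_le_abs _).trans (hle (-τ) (hmem hτ))) (by simpa using hW)
      ⟨by linarith, by linarith⟩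
    simpa using this

/-- `p n` is the `n`-th spatial derivative of `p 0`, and all of them decay rapidly on `s`. -/
structure RapidJet (s : Set ℝ) (p : ℕ → ℝ → ℝ → ℝ) : Prop where
  rapid : ∀ n, RapidOn s (p n)
  hasDerivAt : ∀ n, ∀ t ∈ s, ∀ x, HasDerivAt (fun y => p n y t) (p (n + 1) x t) x

/-- The flux `G` in the local mass conservation law `∂ₜ|u|² = ∂ₓG` for `u = p 0 + i q 0`, where
`m = d + e`. -/
noncomputable def massFlux (a b m : ℝ) (p q : ℕ → ℝ → ℝ → ℝ) (x t : ℝ) : ℝ :=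
  2 * a * (p 0 x t * q 1 x t - q 0 x t * p 1 x t) +
    b * ((p 1 x t ^ 2 + q 1 x t ^ 2) - 2 * (p 0 x t * p 2 x t + q 0 x t * q 2 x t)) -
    m / 2 * (p 0 x t ^ 2 + q 0 x t ^ 2) ^ 2

/-- The spatial derivative of `massFlux`. -/
noncomputable def massFluxDeriv (a b m : ℝ) (p q : ℕ → ℝ → ℝ → ℝ) (x t : ℝ) : ℝ :=
  2 * a * (p 0 x t * q 2 x t - q 0 x t * p 2 x t) -
    2 * b * (p 0 x t * p 3 x t + q 0 x t * q 3 x t) -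
    2 * m * ((p 0 x t ^ 2 + q 0 x t ^ 2) * (p 0 x t * p 1 x t + q 0 x t * q 1 x t))

namespace RapidJet

variable {s : Set ℝ} {p q : ℕ → ℝ → ℝ → ℝ}

theorem rapidOn_sq_add_sq (hp : RapidJet s p) (hq : RapidJet s q) (n : ℕ) :
    RapidOn s fun x t => p n x t ^ 2 + q n x t ^ 2 := by
  simpa only [sq] using ((hp.rapid n).mul (hp.rapid n)).add ((hq.rapid n).mul (hq.rapid n))

theorem rapidOn_inner (hp : RapidJet s p) (hq : RapidJet s q) (m n : ℕ) :
    RapidOn s fun x t => p m x t * p n x t + q m x t * q n x t :=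
  ((hp.rapid m).mul (hp.rapid n)).add ((hq.rapid m).mul (hq.rapid n))

theorem rapidOn_wedge (hp : RapidJet s p) (hq : RapidJet s q) (m n : ℕ) :
    RapidOn s fun x t => p m x t * q n x t - q m x t * p n x t :=
  ((hp.rapid m).mul (hq.rapid n)).sub ((hq.rapid m).mul (hp.rapid n))

theorem rapidOn_sq_add_sq_sq (hp : RapidJet s p) (hq : RapidJet s q) (n : ℕ) :
    RapidOn s fun x t => (p n x t ^ 2 + q n x t ^ 2) ^ 2 := by
  simpa only [sq (_ + _)] using (hp.rapidOn_sq_add_sq hq n).mul (hp.rapidOn_sq_add_sq hq n)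

theorem rapidOn_sq_add_sq_cube (hp : RapidJet s p) (hq : RapidJet s q) (n : ℕ) :
    RapidOn s fun x t => (p n x t ^ 2 + q n x t ^ 2) ^ 3 := by
  simpa only [pow_succ (_ + _) 2] using
    (hp.rapidOn_sq_add_sq_sq hq n).mul (hp.rapidOn_sq_add_sq hq n)

theorem rapidOn_massFlux (hp : RapidJet s p) (hq : RapidJet s q) (a b m : ℝ) :
    RapidOn s (massFlux a b m p q) :=
  (((hp.rapidOn_wedge hq 0 1).const_mul (2 * a)).add
    (((hp.rapidOn_sq_add_sq hq 1).sub ((hp.rapidOn_inner hq 0 2).const_mul 2)).const_mul b)).sub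
    ((hp.rapidOn_sq_add_sq_sq hq 0).const_mul (m / 2))

theorem rapidOn_massFluxDeriv (hp : RapidJet s p) (hq : RapidJet s q) (a b m : ℝ) :
    RapidOn s (massFluxDeriv a b m p q) :=
  (((hp.rapidOn_wedge hq 0 2).const_mul (2 * a)).sub
    ((hp.rapidOn_inner hq 0 3).const_mul (2 * b))).sub
    (((hp.rapidOn_sq_add_sq hq 0).mul (hp.rapidOn_inner hq 0 1)).const_mul (2 * m))

theorem hasDerivAt_sq_add_sq (hp : RapidJet s p) (hq : RapidJet s q) (n : ℕ) {t : ℝ}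
    (ht : t ∈ s) (x : ℝ) : HasDerivAt (fun y => p n y t ^ 2 + q n y t ^ 2)
      (2 * (p n x t * p (n + 1) x t + q n x t * q (n + 1) x t)) x :=
  (((hp.hasDerivAt n t ht x).pow 2).add ((hq.hasDerivAt n t ht x).pow 2)).congr_deriv
    (by push_cast; ring)

theorem hasDerivAt_inner (hp : RapidJet s p) (hq : RapidJet s q) (m n : ℕ) {t : ℝ}
    (ht : t ∈ s) (x : ℝ) :
    HasDerivAt (fun y => p m y t * p n y t + q m y t * q n y t)
      ((p (m + 1) x t * p n x t + p m x t * p (n + 1) x t) +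
        (q (m + 1) x t * q n x t + q m x t * q (n + 1) x t)) x :=
  ((hp.hasDerivAt m t ht x).mul (hp.hasDerivAt n t ht x)).add
    ((hq.hasDerivAt m t ht x).mul (hq.hasDerivAt n t ht x))

theorem hasDerivAt_massFlux (hp : RapidJet s p) (hq : RapidJet s q) (a b m : ℝ) {t : ℝ}
    (ht : t ∈ s) (x : ℝ) :
    HasDerivAt (fun y => massFlux a b m p q y t) (massFluxDeriv a b m p q x t) x := by
  have hJ := (((hp.hasDerivAt 0 t ht x).mul (hq.hasDerivAt 1 t ht x)).sub
    ((hq.hasDerivAt 0 t ht x).mul (hp.hasDerivAt 1 t ht x))).const_mul (2 * a)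
  have hB := ((hp.hasDerivAt_sq_add_sq hq 1 ht x).sub
    ((hp.hasDerivAt_inner hq 0 2 ht x).const_mul 2)).const_mul b
  have hN := ((hp.hasDerivAt_sq_add_sq hq 0 ht x).pow 2).const_mul (m / 2)
  exact ((hJ.add hB).sub hN).congr_deriv (by simp only [massFluxDeriv]; push_cast; ring)

theorem integral_massFluxDeriv (hp : RapidJet s p) (hq : RapidJet s q) (a b m : ℝ) {t : ℝ}
    (ht : t ∈ s) : ∫ x, massFluxDeriv a b m p q x t = 0 :=
  (hp.rapidOn_massFlux hq a b m).integral_deriv_eq_zero (hp.rapidOn_massFluxDeriv hq a b m) ht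
    (hp.hasDerivAt_massFlux hq a b m ht)

/-- Integration by parts in the evolution identity of the weighted mass. -/
theorem integral_sq_mul_massFluxDeriv (hp : RapidJet s p) (hq : RapidJet s q) (a b m : ℝ)
    {t : ℝ} (ht : t ∈ s) :
    ∫ x, x ^ 2 * massFluxDeriv a b m p q x t =
      ∫ x, (-4 * a * (x * (p 0 x t * q 1 x t - q 0 x t * p 1 x t)) +
        6 * b * (x * (p 0 x t * p 2 x t + q 0 x t * q 2 x t)) +
        m * (x * (p 0 x t ^ 2 + q 0 x t ^ 2) ^ 2)) := by
  have hL := (hp.rapidOn_massFluxDeriv hq a b m).pow_mul 2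
  have hR := (((hp.rapidOn_wedge hq 0 1).id_mul.const_mul (-4 * a)).add
    ((hp.rapidOn_inner hq 0 2).id_mul.const_mul (6 * b))).add
    ((hp.rapidOn_sq_add_sq_sq hq 0).id_mul.const_mul m)
  have hF := ((hp.rapidOn_massFlux hq a b m).pow_mul 2).sub
    (((hp.rapidOn_inner hq 0 1).id_mul.sub
      ((hp.rapidOn_sq_add_sq hq 0).const_mul (1 / 2))).const_mul (2 * b))
  rw [← sub_eq_zero, ← integral_sub (hL.integrable ht) (hR.integrable ht)]
  refine hF.integral_deriv_eq_zero (hL.sub hR) ht fun x => ?_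
  have h₁ := ((hasDerivAt_id x).pow 2).mul (hp.hasDerivAt_massFlux hq a b m ht x)
  have h₂ := (((hasDerivAt_id x).mul (hp.hasDerivAt_inner hq 0 1 ht x)).sub
    ((hp.hasDerivAt_sq_add_sq hq 0 ht x).const_mul (1 / 2))).const_mul (2 * b)
  refine (h₁.sub h₂).congr_deriv ?_
  simp only [massFlux, Pi.pow_apply, id]
  push_cast
  ring

/-- `‖u‖₆⁶ ≤ ‖u‖₂⁴ ‖uₓ‖₂²`. -/
theorem integral_cube_le (hp : RapidJet s p) (hq : RapidJet s q) {t : ℝ} (ht : t ∈ s) :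
    ∫ x, (p 0 x t ^ 2 + q 0 x t ^ 2) ^ 3 ≤
      (∫ x, (p 0 x t ^ 2 + q 0 x t ^ 2)) ^ 2 * ∫ x, (p 1 x t ^ 2 + q 1 x t ^ 2) := by
  calc ∫ x, (p 0 x t ^ 2 + q 0 x t ^ 2) ^ 3
      ≤ ∫ x, ((∫ x, (p 0 x t ^ 2 + q 0 x t ^ 2)) * ∫ x, (p 1 x t ^ 2 + q 1 x t ^ 2)) *
          (p 0 x t ^ 2 + q 0 x t ^ 2) := by
        refine integral_mono ((hp.rapidOn_sq_add_sq_cube hq 0).integrable ht)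
          (((hp.rapidOn_sq_add_sq hq 0).const_mul _).integrable ht) fun x => ?_
        have h := sq_add_sq_sq_le_integral_mul_integral (hp.rapid 0) (hq.rapid 0) (hp.rapid 1)
          (hq.rapid 1) ht (hp.hasDerivAt 0 t ht) (hq.hasDerivAt 0 t ht) x
        simp only [pow_succ (_ + _) 2]
        exact mul_le_mul_of_nonneg_right h (by positivity)
    _ = _ := by rw [integral_const_mul]; ring

theorem abs_integral_sq_mul_massFluxDeriv_le (hp : RapidJet s p) (hq : RapidJet s q)
    (a b m : ℝ) {t : ℝ} (ht : t ∈ s) :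
    |∫ x, x ^ 2 * massFluxDeriv a b m p q x t| ≤
      (2 * |a| + 3 * |b| + |m| / 2) * (∫ x, x ^ 2 * (p 0 x t ^ 2 + q 0 x t ^ 2)) +
        2 * |a| * (∫ x, (p 1 x t ^ 2 + q 1 x t ^ 2)) +
        3 * |b| * (∫ x, (p 2 x t ^ 2 + q 2 x t ^ 2)) +
        |m| / 2 * ((∫ x, (p 0 x t ^ 2 + q 0 x t ^ 2)) ^ 2 *
          ∫ x, (p 1 x t ^ 2 + q 1 x t ^ 2)) := by
  have hW := ((hp.rapidOn_sq_add_sq hq 0).pow_mul 2).const_mul (2 * |a| + 3 * |b| + |m| / 2)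
  have h₁ := (hp.rapidOn_sq_add_sq hq 1).const_mul (2 * |a|)
  have h₂ := (hp.rapidOn_sq_add_sq hq 2).const_mul (3 * |b|)
  have h₃ := (hp.rapidOn_sq_add_sq_cube hq 0).const_mul (|m| / 2)
  rw [hp.integral_sq_mul_massFluxDeriv hq a b m ht]
  rw [← Real.norm_eq_abs]
  refine (norm_integral_le_of_norm_le ((((hW.add h₁).add h₂).add h₃).integrable ht)
    (.of_forall fun x => ?_)).trans ?_
  · set N := p 0 x t ^ 2 + q 0 x t ^ 2
    have hN₀ : 0 ≤ N := by positivity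
    have ha : |2 * (x * (p 0 x t * q 1 x t - q 0 x t * p 1 x t))| ≤
        x ^ 2 * N + (p 1 x t ^ 2 + q 1 x t ^ 2) := abs_le.2
      ⟨by nlinarith [sq_nonneg (x * p 0 x t + q 1 x t), sq_nonneg (x * q 0 x t - p 1 x t)],
       by nlinarith [sq_nonneg (x * p 0 x t - q 1 x t), sq_nonneg (x * q 0 x t + p 1 x t)]⟩
    have hb : |2 * (x * (p 0 x t * p 2 x t + q 0 x t * q 2 x t))| ≤
        x ^ 2 * N + (p 2 x t ^ 2 + q 2 x t ^ 2) := abs_le.2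
      ⟨by nlinarith [sq_nonneg (x * p 0 x t + p 2 x t), sq_nonneg (x * q 0 x t + q 2 x t)],
       by nlinarith [sq_nonneg (x * p 0 x t - p 2 x t), sq_nonneg (x * q 0 x t - q 2 x t)]⟩
    have hm : |2 * (x * N ^ 2)| ≤ x ^ 2 * N + N ^ 3 := abs_le.2
      ⟨by nlinarith [mul_nonneg hN₀ (sq_nonneg (x + N))],
       by nlinarith [mul_nonneg hN₀ (sq_nonneg (x - N))]⟩
    rw [Real.norm_eq_abs]
    calc _ = |-2 * a * (2 * (x * (p 0 x t * q 1 x t - q 0 x t * p 1 x t))) +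
          3 * b * (2 * (x * (p 0 x t * p 2 x t + q 0 x t * q 2 x t))) +
          m / 2 * (2 * (x * N ^ 2))| := by congr 1; ring
      _ ≤ 2 * |a| * |2 * (x * (p 0 x t * q 1 x t - q 0 x t * p 1 x t))| +
          3 * |b| * |2 * (x * (p 0 x t * p 2 x t + q 0 x t * q 2 x t))| +
          |m| / 2 * |2 * (x * N ^ 2)| := by
        refine (abs_add_three _ _ _).trans_eq ?_
        rw [abs_mul (-2 * a), abs_mul (3 * b), abs_mul (m / 2), abs_mul (-2) a, abs_mul 3 b,
          abs_div m 2]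
        norm_num
      _ ≤ 2 * |a| * (x ^ 2 * N + (p 1 x t ^ 2 + q 1 x t ^ 2)) +
          3 * |b| * (x ^ 2 * N + (p 2 x t ^ 2 + q 2 x t ^ 2)) +
          |m| / 2 * (x ^ 2 * N + N ^ 3) := by gcongr
      _ = _ := by ring
  · rw [integral_add (((hW.add h₁).add h₂).integrable ht) (h₃.integrable ht),
      integral_add ((hW.add h₁).integrable ht) (h₂.integrable ht),
      integral_add (hW.integrable ht) (h₁.integrable ht)]
    simp only [integral_const_mul]
    gcongr
    exact hp.integral_cube_le hq ht

/-- The weighted a priori estimate for `u = p 0 + i q 0`, given the local conservation law of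
mass. -/
theorem integral_sq_mul_le {T : ℝ} (hT : 0 < T) (hp : RapidJet (Set.Icc (-T) T) p)
    (hq : RapidJet (Set.Icc (-T) T) q) (a b m : ℝ)
    (hmass : ∀ x, ∀ t ∈ Set.Icc (-T) T, HasDerivAt (fun τ => p 0 x τ ^ 2 + q 0 x τ ^ 2)
      (massFluxDeriv a b m p q x t) t) {S₁ S₂ : ℝ}
    (hS₁ : ∀ t ∈ Set.Icc (-T) T, ∫ x, (p 1 x t ^ 2 + q 1 x t ^ 2) ≤ S₁)
    (hS₂ : ∀ t ∈ Set.Icc (-T) T, ∫ x, (p 2 x t ^ 2 + q 2 x t ^ 2) ≤ S₂) {t : ℝ}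
    (ht : t ∈ Set.Icc (-T) T) :
    ∫ x, x ^ 2 * (p 0 x t ^ 2 + q 0 x t ^ 2) ≤
      Real.exp ((2 * |a| + 3 * |b| + |m| / 2) * T) *
        ((∫ x, x ^ 2 * (p 0 x 0 ^ 2 + q 0 x 0 ^ 2)) +
          (2 * |a| + 3 * |b| + |m| / 2) * T *
            ((∫ x, (p 0 x 0 ^ 2 + q 0 x 0 ^ 2)) +
              (1 + (∫ x, (p 0 x 0 ^ 2 + q 0 x 0 ^ 2)) ^ 2) * S₁ + S₂)) := by
  have hN := hp.rapidOn_sq_add_sq hq 0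
  have hD := hp.rapidOn_massFluxDeriv hq a b m
  have h0 : (0 : ℝ) ∈ Set.Icc (-T) T := ⟨by linarith, hT.le⟩
  have hM₀ (τ : ℝ) : 0 ≤ ∫ x, (p 0 x τ ^ 2 + q 0 x τ ^ 2) :=
    integral_nonneg fun x => by positivity
  have hK₁ (τ : ℝ) : 0 ≤ ∫ x, (p 1 x τ ^ 2 + q 1 x τ ^ 2) :=
    integral_nonneg fun x => by positivity
  have hK₂ (τ : ℝ) : 0 ≤ ∫ x, (p 2 x τ ^ 2 + q 2 x τ ^ 2) :=
    integral_nonneg fun x => by positivity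
  have hW₀ (τ : ℝ) : 0 ≤ ∫ x, x ^ 2 * (p 0 x τ ^ 2 + q 0 x τ ^ 2) :=
    integral_nonneg fun x => by positivity
  have hS₁₀ : 0 ≤ S₁ := (hK₁ 0).trans (hS₁ 0 h0)
  have hS₂₀ : 0 ≤ S₂ := (hK₂ 0).trans (hS₂ 0 h0)
  have hM (τ : ℝ) (hτ : τ ∈ Set.Icc (-T) T) :
      ∫ x, (p 0 x τ ^ 2 + q 0 x τ ^ 2) ≤ ∫ x, (p 0 x 0 ^ 2 + q 0 x 0 ^ 2) := by
    have h := le_exp_mul_of_abs_deriv_le (W := fun τ => ∫ x, (p 0 x τ ^ 2 + q 0 x τ ^ 2))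
      (W' := fun τ => ∫ x, massFluxDeriv a b m p q x τ) (T := T) le_rfl le_rfl
      (hN.continuousOn_integral fun x τ hτ => (hmass x τ hτ).continuousAt.continuousWithinAt)
      (fun τ hτ => hN.hasDerivAt_integral hD (Icc_mem_nhds hτ.1 hτ.2) hmass)
      (fun τ hτ => by
        simp [hp.integral_massFluxDeriv hq a b m (Set.Ioo_subset_Icc_self hτ)])
      (hM₀ 0) hτ
    simpa using h
  refine le_exp_mul_of_abs_deriv_le (W := fun τ => ∫ x, x ^ 2 * (p 0 x τ ^ 2 + q 0 x τ ^ 2))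
    (W' := fun τ => ∫ x, x ^ 2 * massFluxDeriv a b m p q x τ) (by positivity)
    (add_nonneg (add_nonneg (hM₀ 0) (by positivity)) hS₂₀)
    ((hN.pow_mul 2).continuousOn_integral fun x τ hτ =>
      ((hmass x τ hτ).const_mul (x ^ 2)).continuousAt.continuousWithinAt)
    (fun τ hτ => (hN.pow_mul 2).hasDerivAt_integral (hD.pow_mul 2) (Icc_mem_nhds hτ.1 hτ.2)
      fun x σ hσ => (hmass x σ hσ).const_mul (x ^ 2))
    (fun τ hτ => ?_) (hW₀ 0) ht
  replace hτ := Set.Ioo_subset_Icc_self hτ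
  refine (hp.abs_integral_sq_mul_massFluxDeriv_le hq a b m hτ).trans ?_
  set M := ∫ x, (p 0 x 0 ^ 2 + q 0 x 0 ^ 2)
  have hM₀₀ : 0 ≤ M := hM₀ 0
  have hsq : (∫ x, (p 0 x τ ^ 2 + q 0 x τ ^ 2)) ^ 2 ≤ M ^ 2 :=
    pow_le_pow_left₀ (hM₀ τ) (hM τ hτ) 2
  have hMS : 0 ≤ M ^ 2 * S₁ := by positivity
  have e₁ : 2 * |a| * (∫ x, (p 1 x τ ^ 2 + q 1 x τ ^ 2)) ≤
      2 * |a| * (M + (1 + M ^ 2) * S₁ + S₂) :=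
    mul_le_mul_of_nonneg_left (by linarith [hS₁ τ hτ]) (by positivity)
  have e₂ : 3 * |b| * (∫ x, (p 2 x τ ^ 2 + q 2 x τ ^ 2)) ≤
      3 * |b| * (M + (1 + M ^ 2) * S₁ + S₂) :=
    mul_le_mul_of_nonneg_left (by linarith [hS₂ τ hτ]) (by positivity)
  have e₃ : |m| / 2 * ((∫ x, (p 0 x τ ^ 2 + q 0 x τ ^ 2)) ^ 2 *
      ∫ x, (p 1 x τ ^ 2 + q 1 x τ ^ 2)) ≤ |m| / 2 * (M + (1 + M ^ 2) * S₁ + S₂) :=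
    mul_le_mul_of_nonneg_left
      (by linarith [mul_le_mul hsq (hS₁ τ hτ) (hK₁ τ) (sq_nonneg M)]) (by positivity)
  linarith

end RapidJet

/-- The local conservation law of mass at a point of a solution `u = p 0 + i q 0`. -/
theorem two_mul_inner_deriv_eq_massFluxDeriv {a b c d e : ℝ} {u : ℝ → ℝ → ℂ} {x t : ℝ}
    (hu : DifferentiableAt ℝ (fun y => u y t) x) (h : airyEqAt a b c d e u x t) :
    2 * ((u x t).re * (deriv (fun τ => u x τ) t).re +
        (u x t).im * (deriv (fun τ => u x τ) t).im) =
      massFluxDeriv a b (d + e) (fun n x t => (iteratedDeriv n (fun y => u y t) x).re)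
        (fun n x t => (iteratedDeriv n (fun y => u y t) x).im) x t := by
  have hconj : deriv (fun y => (starRingEnd ℂ) (u y t)) x =
      (starRingEnd ℂ) (deriv (fun y => u y t) x) := hu.hasDerivAt.star.deriv
  have hnorm : ((‖u x t‖ : ℂ)) ^ 2 = (((u x t).re ^ 2 + (u x t).im ^ 2 : ℝ) : ℂ) := by
    rw [← Complex.ofReal_pow, Complex.sq_norm, Complex.normSq_apply, sq, sq]
  rw [airyEqAt, hconj, hnorm] at h
  have hre := congrArg Complex.re h
  have him := congrArg Complex.im h
  simp only [sq (u x t), Complex.add_re, Complex.add_im, Complex.mul_re, Complex.mul_im,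
    Complex.I_re, Complex.I_im, Complex.ofReal_re, Complex.ofReal_im, Complex.conj_re,
    Complex.conj_im, Complex.zero_re, Complex.zero_im] at hre him
  simp only [massFluxDeriv, iteratedDeriv_zero, iteratedDeriv_one]
  linear_combination 2 * (u x t).re * hre + 2 * (u x t).im * him

/-- The real-linear images of the spatial derivatives of a smooth rapidly decaying family form a
`RapidJet`. -/
theorem rapidJet_of_contDiff {u : ℝ → ℝ → ℂ} {T : ℝ}
    (hsmooth : ∀ t, ContDiff ℝ (⊤ : ℕ∞) fun y => u y t)
    (hdecay : ∀ (k n : ℕ), ∃ C, ∀ x t : ℝ, |t| ≤ T →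
      |x| ^ k * ‖iteratedDeriv n (fun y => u y t) x‖ ≤ C) (L : ℂ →L[ℝ] ℝ)
    (hL : ∀ z, |L z| ≤ ‖z‖) :
    RapidJet (Set.Icc (-T) T) fun n x t => L (iteratedDeriv n (fun y => u y t) x) where
  rapid n := by
    refine ⟨fun t _ => L.continuous.comp
      ((hsmooth t).continuous_iteratedDeriv n (mod_cast le_top)), fun k => ?_⟩
    obtain ⟨C, hC⟩ := hdecay k n
    exact ⟨C, fun x t ht => (mul_le_mul_of_nonneg_left (hL _) (by positivity)).trans
      (hC x t (abs_le.2 ht))⟩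
  hasDerivAt n t _ x := by
    refine L.hasFDerivAt.comp_hasDerivAt x ?_
    rw [iteratedDeriv_succ]
    exact ((hsmooth t).differentiable_iteratedDeriv n
      (mod_cast ENat.natCast_lt_top n) x).hasDerivAt

/-- weighted a priori estimate, Proposition 3.2 for classical
solutions. With `a₀ = 2|a| + 3|b| + |d+e|/2` and
`A = ‖u(0)‖²_{L²} + (1 + ‖u(0)‖⁴_{L²})·sup_t ‖∂ₓu(t)‖²_{L²} + sup_t ‖∂ₓ²u(t)‖²_{L²}`
(the sups over `t ∈ [−T,T]`, assumed finite), every classical solution satisfies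
`∫ x²|u(x,t)|² dx ≤ e^{a₀T} (∫ x²|u(x,0)|² dx + a₀ T A)` for `t ∈ [−T,T]`. -/
theorem weighted_apriori_estimate (a b c d e T : ℝ) (hT : 0 < T) (u : ℝ → ℝ → ℂ)
    (hsmooth : ContDiff ℝ (⊤ : ℕ∞) (fun p : ℝ × ℝ => u p.1 p.2))
    (hdecay : ∀ (k n : ℕ), ∃ C, ∀ x t : ℝ, |t| ≤ T →
      |x| ^ k * ‖iteratedDeriv n (fun y => u y t) x‖ ≤ C)
    (heq : ∀ x t : ℝ, t ∈ Set.Icc (-T) T → airyEqAt a b c d e u x t)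
    (hbdd1 : BddAbove
      ((fun t => ∫ x : ℝ, ‖deriv (fun y => u y t) x‖ ^ 2) '' Set.Icc (-T) T))
    (hbdd2 : BddAbove
      ((fun t => ∫ x : ℝ, ‖iteratedDeriv 2 (fun y => u y t) x‖ ^ 2) '' Set.Icc (-T) T)) :
    ∀ t ∈ Set.Icc (-T) T,
      (∫ x : ℝ, x ^ 2 * ‖u x t‖ ^ 2) ≤
        Real.exp ((2 * |a| + 3 * |b| + |d + e| / 2) * T) *
          ((∫ x : ℝ, x ^ 2 * ‖u x 0‖ ^ 2) +
            (2 * |a| + 3 * |b| + |d + e| / 2) * T *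
              ((∫ x : ℝ, ‖u x 0‖ ^ 2) +
                (1 + (∫ x : ℝ, ‖u x 0‖ ^ 2) ^ 2) *
                  sSup ((fun t => ∫ x : ℝ, ‖deriv (fun y => u y t) x‖ ^ 2) ''
                    Set.Icc (-T) T) +
                sSup ((fun t => ∫ x : ℝ, ‖iteratedDeriv 2 (fun y => u y t) x‖ ^ 2) ''
                  Set.Icc (-T) T))) := by
  have hslice (t : ℝ) : ContDiff ℝ (⊤ : ℕ∞) fun y => u y t :=
    hsmooth.comp (contDiff_id.prodMk contDiff_const)
  have htime (x : ℝ) : ContDiff ℝ (⊤ : ℕ∞) fun τ => u x τ :=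
    hsmooth.comp (contDiff_const.prodMk contDiff_id)
  have hp := rapidJet_of_contDiff hslice hdecay Complex.reCLM Complex.abs_re_le_norm
  have hq := rapidJet_of_contDiff hslice hdecay Complex.imCLM Complex.abs_im_le_norm
  have hnorm (z : ℂ) : ‖z‖ ^ 2 = z.re ^ 2 + z.im ^ 2 := by
    rw [Complex.sq_norm, Complex.normSq_apply, sq, sq]
  intro t ht
  have h := hp.integral_sq_mul_le hT hq a b (d + e) (fun x t ht => ?_)
    (S₁ := sSup ((fun t => ∫ x : ℝ, ‖deriv (fun y => u y t) x‖ ^ 2) '' Set.Icc (-T) T))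
    (S₂ := sSup ((fun t => ∫ x : ℝ, ‖iteratedDeriv 2 (fun y => u y t) x‖ ^ 2) ''
      Set.Icc (-T) T))
    (fun t ht => ?_) (fun t ht => ?_) ht
  · simpa only [Complex.reCLM_apply, Complex.imCLM_apply, iteratedDeriv_zero, ← hnorm] using h
  · have hd := ((htime x).differentiable (by simp) t).hasDerivAt
    have hre := Complex.reCLM.hasFDerivAt.comp_hasDerivAt t hd
    have him := Complex.imCLM.hasFDerivAt.comp_hasDerivAt t hd
    simp only [iteratedDeriv_zero]
    refine ((hre.pow 2).add (him.pow 2)).congr_deriv ?_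
    refine Eq.trans ?_ (two_mul_inner_deriv_eq_massFluxDeriv
      ((hslice t).differentiable (by simp) x) (heq x t ht))
    simp only [Function.comp_apply, Complex.reCLM_apply, Complex.imCLM_apply]
    push_cast
    ring
  · simp only [Complex.reCLM_apply, Complex.imCLM_apply, ← hnorm, iteratedDeriv_one]
    exact le_csSup hbdd1 ⟨t, ht, rfl⟩
  · simp only [Complex.reCLM_apply, Complex.imCLM_apply, ← hnorm]
    exact le_csSup hbdd2 ⟨t, ht, rfl⟩
end

section
/- Conservation of energy I₂. Let a, b, c, d, e ∈ ℝ with b·e ≠ 0, and set C₁ = 3be, C₂ = −e(e+d)/2, C₃ = 3bc − a(d+e). Let u : ℝ × ℝ → ℂ be a smooth function, Schwartz in x for each t (with estimates locally uniform in t), satisfying pointwise ∂_t u + i a ∂_x² u + b ∂_x³ u + i c |u|² u + d |u|² ∂_x u + e u² ∂_x ū = 0. Then the quantity I₂(u(t)) = C₁ ∫_ℝ |∂_x u(x,t)|² dx + C₂ ∫_ℝ |u(x,t)|⁴ dx + C₃ · Im( ∫_ℝ u(x,t) ∂_x ū(x,t) dx ) is independent of t. -/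
open MeasureTheory Complex

/-- Continuity in `x` together with decay faster than any power of `x`, locally uniformly
in `t`. -/
def RapidDecay (f : ℝ → ℝ → ℂ) : Prop :=
  (∀ t, Continuous fun x => f x t) ∧
    ∀ (k : ℕ) (T : ℝ), 0 < T → ∃ C, ∀ x t : ℝ, |t| ≤ T → |x| ^ k * ‖f x t‖ ≤ C

namespace RapidDecay

variable {f g : ℝ → ℝ → ℂ}

theorem add (hf : RapidDecay f) (hg : RapidDecay g) : RapidDecay fun x t => f x t + g x t := by
  refine ⟨fun t => (hf.1 t).add (hg.1 t), fun k T hT => ?_⟩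
  obtain ⟨A, hA⟩ := hf.2 k T hT
  obtain ⟨B, hB⟩ := hg.2 k T hT
  refine ⟨A + B, fun x t ht => ?_⟩
  calc |x| ^ k * ‖f x t + g x t‖ ≤ |x| ^ k * (‖f x t‖ + ‖g x t‖) := by
        gcongr; exact norm_add_le _ _
    _ ≤ A + B := by linarith [hA x t ht, hB x t ht]

theorem mul (hf : RapidDecay f) (hg : RapidDecay g) : RapidDecay fun x t => f x t * g x t := by
  refine ⟨fun t => (hf.1 t).mul (hg.1 t), fun k T hT => ?_⟩
  obtain ⟨A, hA⟩ := hf.2 k T hT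
  obtain ⟨B, hB⟩ := hg.2 0 T hT
  refine ⟨A * B, fun x t ht => ?_⟩
  have hA' := hA x t ht
  have hB' : ‖g x t‖ ≤ B := by simpa using hB x t ht
  have h0 : 0 ≤ |x| ^ k * ‖f x t‖ := by positivity
  rw [norm_mul, ← mul_assoc]
  exact mul_le_mul hA' hB' (norm_nonneg _) (h0.trans hA')

theorem const_mul (c : ℂ) (hf : RapidDecay f) : RapidDecay fun x t => c * f x t := by
  refine ⟨fun t => (hf.1 t).const_mul c, fun k T hT => ?_⟩
  obtain ⟨A, hA⟩ := hf.2 k T hT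
  refine ⟨‖c‖ * A, fun x t ht => ?_⟩
  rw [norm_mul, mul_left_comm]
  exact mul_le_mul_of_nonneg_left (hA x t ht) (norm_nonneg c)

theorem neg (hf : RapidDecay f) : RapidDecay fun x t => -f x t := by
  simpa using hf.const_mul (-1)

theorem sub (hf : RapidDecay f) (hg : RapidDecay g) : RapidDecay fun x t => f x t - g x t := by
  simpa [sub_eq_add_neg] using hf.add hg.neg

theorem conj (hf : RapidDecay f) : RapidDecay fun x t => (starRingEnd ℂ) (f x t) :=
  ⟨fun t => Complex.continuous_conj.comp (hf.1 t), fun k T hT => by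
    simpa only [RCLike.norm_conj] using hf.2 k T hT⟩

theorem exists_bound (hf : RapidDecay f) {T : ℝ} (hT : 0 < T) :
    ∃ C, ∀ x t : ℝ, |t| ≤ T → ‖f x t‖ ≤ C * (1 + x ^ 2)⁻¹ := by
  obtain ⟨A, hA⟩ := hf.2 0 T hT
  obtain ⟨B, hB⟩ := hf.2 2 T hT
  refine ⟨A + B, fun x t ht => ?_⟩
  have hA' := hA x t ht
  have hB' := hB x t ht
  rw [sq_abs] at hB'
  rw [← div_eq_mul_inv, le_div_iff₀ (by positivity)]
  linarith

theorem integrable (hf : RapidDecay f) (t : ℝ) : Integrable fun x => f x t := by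
  obtain ⟨C, hC⟩ := hf.exists_bound (T := |t| + 1) (by positivity)
  exact (integrable_inv_one_add_sq.const_mul C).mono' (hf.1 t).aestronglyMeasurable
    (.of_forall fun x => hC x t (by linarith))

/-- A rapidly decaying density `ρ` satisfying a conservation law `∂ₜρ = ∂ₓF` has constant
integral. -/
theorem integral_eq_of_conservation_law {ρ G F : ℝ → ℝ → ℂ} (hρ : RapidDecay ρ)
    (hG : RapidDecay G) (hF : RapidDecay F)
    (hρG : ∀ x t, HasDerivAt (fun τ => ρ x τ) (G x t) t)
    (hFG : ∀ x t, HasDerivAt (fun y => F y t) (G x t) x) (s t : ℝ) :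
    ∫ x, ρ x s = ∫ x, ρ x t := by
  have key : ∀ t, HasDerivAt (fun τ => ∫ x, ρ x τ) 0 t := by
    intro t
    obtain ⟨C, hC⟩ := hG.exists_bound (T := |t| + 1) (by positivity)
    have h := (hasDerivAt_integral_of_dominated_loc_of_deriv_le (μ := volume)
      (F := fun τ x => ρ x τ) (F' := fun τ x => G x τ) (Metric.ball_mem_nhds t one_pos)
      (.of_forall fun τ => (hρ.1 τ).aestronglyMeasurable) (hρ.integrable t)
      (hG.1 t).aestronglyMeasurable
      (.of_forall fun x τ hτ => hC x τ ?_)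
      (integrable_inv_one_add_sq.const_mul C)
      (.of_forall fun x τ _ => hρG x τ)).2
    · rwa [integral_eq_zero_of_hasDerivAt_of_integrable (fun x => hFG x t) (hG.integrable t)
        (hF.integrable t)] at h
    · rw [Metric.mem_ball, Real.dist_eq] at hτ
      linarith [abs_sub_abs_le_abs_sub τ t]
  exact is_const_of_deriv_eq_zero (fun t => (key t).differentiableAt) (fun t => (key t).deriv) s t

end RapidDecay

/-- If `∂ₜf = R` for a function `f` of class `C²`, then `∂ₜ∂ₓf = ∂ₓR`. -/
theorem hasDerivAt_deriv_of_contDiff_two {E : Type*} [NormedAddCommGroup E] [NormedSpace ℝ E]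
    {f R : ℝ → ℝ → E} {R' : E} {x t : ℝ}
    (hf : ContDiff ℝ 2 fun p : ℝ × ℝ => f p.1 p.2)
    (hR : ∀ y, HasDerivAt (fun τ => f y τ) (R y t) t)
    (hR' : HasDerivAt (fun y => R y t) R' x) :
    HasDerivAt (fun τ => deriv (fun y => f y τ) x) R' t := by
  set φ : ℝ × ℝ → E := fun p => f p.1 p.2 with hφ
  have hd (p : ℝ × ℝ) : HasFDerivAt φ (fderiv ℝ φ p) p :=
    (hf.differentiable (by norm_num) p).hasFDerivAt
  have hx (y τ : ℝ) : HasDerivAt (fun z : ℝ => (z, τ)) ((1 : ℝ), (0 : ℝ)) y :=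
    (hasDerivAt_id y).prodMk (hasDerivAt_const y τ)
  have ht (y τ : ℝ) : HasDerivAt (fun σ : ℝ => (y, σ)) ((0 : ℝ), (1 : ℝ)) τ :=
    (hasDerivAt_const τ y).prodMk (hasDerivAt_id τ)
  have hfx (τ : ℝ) : HasDerivAt (fun y => f y τ) (fderiv ℝ φ (x, τ) (1, 0)) x :=
    HasFDerivAt.comp_hasDerivAt (f := fun z : ℝ => (z, τ)) x (hd (x, τ)) (hx x τ)
  have hft (y : ℝ) : HasDerivAt (fun τ => f y τ) (fderiv ℝ φ (y, t) (0, 1)) t :=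
    HasFDerivAt.comp_hasDerivAt (f := fun σ : ℝ => (y, σ)) t (hd (y, t)) (ht y t)
  have hdd : HasFDerivAt (fderiv ℝ φ) (fderiv ℝ (fderiv ℝ φ) (x, t)) (x, t) :=
    ((hf.fderiv_right (m := 1) (by norm_num)).differentiable (by norm_num) _).hasFDerivAt
  have h1 : HasDerivAt (fun y => fderiv ℝ φ (y, t) (0, 1))
      (fderiv ℝ (fderiv ℝ φ) (x, t) (1, 0) (0, 1)) x := by
    simpa using (HasFDerivAt.comp_hasDerivAt (f := fun z : ℝ => (z, t)) x hdd (hx x t)).clm_apply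
      (hasDerivAt_const x ((0 : ℝ), (1 : ℝ)))
  have h2 : HasDerivAt (fun τ => fderiv ℝ φ (x, τ) (1, 0))
      (fderiv ℝ (fderiv ℝ φ) (x, t) (0, 1) (1, 0)) t := by
    simpa using (HasFDerivAt.comp_hasDerivAt (f := fun σ : ℝ => (x, σ)) t hdd (ht x t)).clm_apply
      (hasDerivAt_const t ((1 : ℝ), (0 : ℝ)))
  have hsymm : IsSymmSndFDerivAt ℝ φ (x, t) := hf.contDiffAt.isSymmSndFDerivAt (by simp)
  rw [show (fun y => R y t) = fun y => fderiv ℝ φ (y, t) (0, 1) from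
    funext fun y => (hR y).unique (hft y)] at hR'
  rw [hR'.unique h1, hsymm.eq (1, 0) (0, 1)]
  simpa only [(hfx _).deriv] using h2

theorem HasDerivAt.complex_conj {f : ℝ → ℂ} {f' : ℂ} {x : ℝ} (hf : HasDerivAt f f' x) :
    HasDerivAt (fun y => (starRingEnd ℂ) (f y)) ((starRingEnd ℂ) f') x :=
  hf.star

/-- The local form of the conservation of energy: along the equation the energy density of
`u` with `x`-jet `U` is transported by an explicit flux. Here `V` is the conjugate jet, `R`, `S`
are the time derivatives of `U 0`, `V 0`, and `R'`, `S'` those of `U 1`, `V 1`. -/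
theorem integral_energy_density_eq (a b c d e : ℝ) {U V : ℕ → ℝ → ℝ → ℂ}
    {R S R' S' : ℝ → ℝ → ℂ}
    (hUd : ∀ n, RapidDecay (U n)) (hVd : ∀ n, RapidDecay (V n))
    (hUx : ∀ n x t, HasDerivAt (fun y => U n y t) (U (n + 1) x t) x)
    (hVx : ∀ n x t, HasDerivAt (fun y => V n y t) (V (n + 1) x t) x)
    (hRd : RapidDecay R) (hSd : RapidDecay S) (hRd' : RapidDecay R') (hSd' : RapidDecay S')
    (hRx : ∀ x t, HasDerivAt (fun y => R y t) (R' x t) x)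
    (hSx : ∀ x t, HasDerivAt (fun y => S y t) (S' x t) x)
    (hUt : ∀ x t, HasDerivAt (fun τ => U 0 x τ) (R x t) t)
    (hVt : ∀ x t, HasDerivAt (fun τ => V 0 x τ) (S x t) t)
    (hUt' : ∀ x t, HasDerivAt (fun τ => U 1 x τ) (R' x t) t)
    (hVt' : ∀ x t, HasDerivAt (fun τ => V 1 x τ) (S' x t) t)
    (hR : ∀ x t, R x t = -(I * a * U 2 x t + b * U 3 x t + I * c * (U 0 x t * V 0 x t) * U 0 x t
      + d * (U 0 x t * V 0 x t) * U 1 x t + e * (U 0 x t * U 0 x t) * V 1 x t))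
    (hS : ∀ x t, S x t = -(-I * a * V 2 x t + b * V 3 x t - I * c * (U 0 x t * V 0 x t) * V 0 x t
      + d * (U 0 x t * V 0 x t) * V 1 x t + e * (V 0 x t * V 0 x t) * U 1 x t)) (s t : ℝ) :
    ∫ x, ((3 * b * e : ℂ) * (U 1 x s * V 1 x s)
        + (-(e * (e + d)) / 2 : ℂ) * (U 0 x s * V 0 x s * (U 0 x s * V 0 x s))
        + (3 * b * c - a * (d + e) : ℂ) * ((-(I / 2)) * (U 0 x s * V 1 x s - V 0 x s * U 1 x s)))
      = ∫ x, ((3 * b * e : ℂ) * (U 1 x t * V 1 x t)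
        + (-(e * (e + d)) / 2 : ℂ) * (U 0 x t * V 0 x t * (U 0 x t * V 0 x t))
        + (3 * b * c - a * (d + e) : ℂ) * ((-(I / 2)) * (U 0 x t * V 1 x t - V 0 x t * U 1 x t))) := by
  refine RapidDecay.integral_eq_of_conservation_law
    (ρ := fun x s => (3 * b * e : ℂ) * (U 1 x s * V 1 x s)
        + (-(e * (e + d)) / 2 : ℂ) * (U 0 x s * V 0 x s * (U 0 x s * V 0 x s))
        + (3 * b * c - a * (d + e) : ℂ) * ((-(I / 2)) * (U 0 x s * V 1 x s - V 0 x s * U 1 x s)))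
    (G := fun x s => (3 * b * e : ℂ) * (R' x s * V 1 x s + U 1 x s * S' x s)
        + (-(e * (e + d)) / 2 : ℂ) * (2 * ((R x s * V 0 x s + U 0 x s * S x s)
            * (U 0 x s * V 0 x s)))
        + (3 * b * c - a * (d + e) : ℂ) * ((-(I / 2)) *
          ((R x s * V 1 x s + U 0 x s * S' x s) - (S x s * U 1 x s + V 0 x s * R' x s))))
    (F := fun x s => (3 * b * e : ℂ) *
          (R x s * V 1 x s + U 1 x s * S x s + b * (U 2 x s * V 2 x s)
            + (I * c) * (U 0 x s * V 0 x s * (U 0 x s * V 1 x s - V 0 x s * U 1 x s))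
            + d * (U 0 x s * V 0 x s * (U 1 x s * V 1 x s))
            + (e / 2) * (U 0 x s * U 0 x s * (V 1 x s * V 1 x s)
              + V 0 x s * V 0 x s * (U 1 x s * U 1 x s)))
        + (-(e * (e + d)) / 2 : ℂ) *
          ((-2 * I * a) * (U 0 x s * V 0 x s * (V 0 x s * U 1 x s - U 0 x s * V 1 x s))
            + (-2 * b) * (U 0 x s * V 0 x s * (V 0 x s * U 2 x s + U 0 x s * V 2 x s)
              - (1 / 2) * (U 1 x s * U 1 x s * (V 0 x s * V 0 x s)
                + V 1 x s * V 1 x s * (U 0 x s * U 0 x s))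
              - 2 * (U 0 x s * V 0 x s * (U 1 x s * V 1 x s)))
            + (-(2 / 3) * (d + e)) *
              (U 0 x s * V 0 x s * (U 0 x s * V 0 x s) * (U 0 x s * V 0 x s)))
        + (3 * b * c - a * (d + e) : ℂ) * ((-(I / 2)) *
          (U 0 x s * S x s - V 0 x s * R x s
            - 2 * ((I * a) * (U 1 x s * V 1 x s)
              + b * (U 2 x s * V 1 x s - V 2 x s * U 1 x s)
              + (I * c / 2) * (U 0 x s * V 0 x s * (U 0 x s * V 0 x s))))))
    ?_ ?_ ?_ ?_ ?_ s t
  iterate 3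
    repeat' first
      | exact hUd _ | exact hVd _ | assumption
      | apply RapidDecay.const_mul | apply RapidDecay.add | apply RapidDecay.sub
      | apply RapidDecay.mul
  · intro x t
    apply HasDerivAt.congr_deriv
    · repeat' first
        | exact hUt x t | exact hVt x t | exact hUt' x t | exact hVt' x t
        | apply HasDerivAt.const_mul | apply HasDerivAt.fun_add | apply HasDerivAt.fun_sub
        | apply HasDerivAt.fun_mul
    · ring
  · intro x t
    apply HasDerivAt.congr_deriv
    · repeat' first
        | exact hUx _ x t | exact hVx _ x t | exact hRx x t | exact hSx x t
        | apply HasDerivAt.const_mul | apply HasDerivAt.fun_add | apply HasDerivAt.fun_sub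
        | apply HasDerivAt.fun_mul
    · simp only [hR, hS, zero_add, Nat.reduceAdd]
      ring

/-- conservation of the energy `I₂`, quantity (1.3). With
`C₁ = 3be`, `C₂ = −e(e+d)/2`, `C₃ = 3bc − a(d+e)`, the functional
`I₂(u(t)) = C₁∫|∂ₓu|² + C₂∫|u|⁴ + C₃ Im ∫ u ∂ₓū` is independent of `t`
along smooth solutions that are Schwartz in `x` locally uniformly in `t`. -/
theorem conservation_of_energy (a b c d e : ℝ) (hbe : b * e ≠ 0) (u : ℝ → ℝ → ℂ)
    (hsmooth : ContDiff ℝ (⊤ : ℕ∞) (fun p : ℝ × ℝ => u p.1 p.2))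
    (hdecay : ∀ (k n : ℕ) (T : ℝ), 0 < T → ∃ C, ∀ x t : ℝ, |t| ≤ T →
      |x| ^ k * ‖iteratedDeriv n (fun y => u y t) x‖ ≤ C)
    (heq : AirySchrodingerEq a b c d e u) :
    ∀ t : ℝ,
      (3 * b * e) * (∫ x : ℝ, ‖deriv (fun y => u y t) x‖ ^ 2)
        + (-(e * (e + d)) / 2) * (∫ x : ℝ, ‖u x t‖ ^ 4)
        + (3 * b * c - a * (d + e)) *
            (∫ x : ℝ, u x t * deriv (fun y => (starRingEnd ℂ) (u y t)) x).im =
      (3 * b * e) * (∫ x : ℝ, ‖deriv (fun y => u y 0) x‖ ^ 2)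
        + (-(e * (e + d)) / 2) * (∫ x : ℝ, ‖u x 0‖ ^ 4)
        + (3 * b * c - a * (d + e)) *
            (∫ x : ℝ, u x 0 * deriv (fun y => (starRingEnd ℂ) (u y 0)) x).im := by
  have hslice (t : ℝ) : ContDiff ℝ (⊤ : ℕ∞) fun y => u y t :=
    hsmooth.comp (contDiff_id.prodMk contDiff_const)
  set U : ℕ → ℝ → ℝ → ℂ := fun n x t => iteratedDeriv n (fun y => u y t) x with hU
  set V : ℕ → ℝ → ℝ → ℂ := fun n x t => (starRingEnd ℂ) (U n x t) with hV
  have hU0 (x t : ℝ) : U 0 x t = u x t := by simp [hU]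
  have hU1 (x t : ℝ) : U 1 x t = deriv (fun y => u y t) x := by simp [hU]
  have hUx (n : ℕ) (x t : ℝ) : HasDerivAt (fun y => U n y t) (U (n + 1) x t) x := by
    have h := ((hslice t).differentiable_iteratedDeriv n
      (by exact_mod_cast WithTop.coe_lt_top n) x).hasDerivAt
    rwa [← iteratedDeriv_succ] at h
  have hVx (n : ℕ) (x t : ℝ) : HasDerivAt (fun y => V n y t) (V (n + 1) x t) x :=
    (hUx n x t).complex_conj
  have hV1 (x t : ℝ) : V 1 x t = deriv (fun y => (starRingEnd ℂ) (u y t)) x := by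
    simpa only [hV, hU0] using (hVx 0 x t).deriv.symm
  have hUd (n : ℕ) : RapidDecay (U n) :=
    ⟨fun t => continuous_iff_continuousAt.2 fun x => (hUx n x t).continuousAt,
      fun k => hdecay k n⟩
  have hVd (n : ℕ) : RapidDecay (V n) := (hUd n).conj
  set R : ℝ → ℝ → ℂ := fun x t =>
    -((I * a) * U 2 x t + b * U 3 x t + (I * c) * (U 0 x t * V 0 x t * U 0 x t)
      + d * (U 0 x t * V 0 x t * U 1 x t) + e * (U 0 x t * U 0 x t * V 1 x t)) with hR
  set R' : ℝ → ℝ → ℂ := fun x t =>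
    -((I * a) * U 3 x t + b * U 4 x t
      + (I * c) * ((U 1 x t * V 0 x t + U 0 x t * V 1 x t) * U 0 x t
        + U 0 x t * V 0 x t * U 1 x t)
      + d * ((U 1 x t * V 0 x t + U 0 x t * V 1 x t) * U 1 x t + U 0 x t * V 0 x t * U 2 x t)
      + e * ((U 1 x t * U 0 x t + U 0 x t * U 1 x t) * V 1 x t + U 0 x t * U 0 x t * V 2 x t))
  have hRd : RapidDecay R := by
    apply RapidDecay.neg
    repeat' first
      | exact hUd _ | exact hVd _ | apply RapidDecay.const_mul | apply RapidDecay.add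
      | apply RapidDecay.mul
  have hRd' : RapidDecay R' := by
    apply RapidDecay.neg
    repeat' first
      | exact hUd _ | exact hVd _ | apply RapidDecay.const_mul | apply RapidDecay.add
      | apply RapidDecay.mul
  have hRx (x t : ℝ) : HasDerivAt (fun y => R y t) (R' x t) x := by
    apply HasDerivAt.fun_neg
    repeat' first
      | exact hUx _ x t | exact hVx _ x t | apply HasDerivAt.const_mul
      | apply HasDerivAt.fun_add | apply HasDerivAt.fun_mul
  have hut (x t : ℝ) : HasDerivAt (fun τ => u x τ) (R x t) t := by
    have hd : DifferentiableAt ℝ (fun τ => u x τ) t :=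
      (hsmooth.comp (contDiff_const.prodMk contDiff_id)).differentiable (by simp) t
    refine hd.hasDerivAt.congr_deriv ?_
    have h := heq x t
    rw [← hU1, ← hV1, ← hU0, ← Complex.mul_conj'] at h
    linear_combination h
  have hUt (x t : ℝ) : HasDerivAt (fun τ => U 0 x τ) (R x t) t := by
    simpa only [hU0] using hut x t
  have hUt' (x t : ℝ) : HasDerivAt (fun τ => U 1 x τ) (R' x t) t := by
    simpa only [hU1] using hasDerivAt_deriv_of_contDiff_two
      (contDiff_infty.1 hsmooth 2) (fun y => hut y t) (hRx x t)
  have hconst := integral_energy_density_eq a b c d e hUd hVd hUx hVx hRd hRd.conj hRd' hRd'.conj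
    hRx (fun x t => (hRx x t).complex_conj) hUt (fun x t => (hUt x t).complex_conj)
    hUt' (fun x t => (hUt' x t).complex_conj) (fun x t => by simp only [hR]; ring)
    (fun x t => by
      simp only [hR, hV, map_neg, map_add, map_mul, Complex.conj_I, Complex.conj_ofReal,
        Complex.conj_conj]
      ring)
  have henergy (t : ℝ) :
      (((3 * b * e) * (∫ x : ℝ, ‖deriv (fun y => u y t) x‖ ^ 2)
        + (-(e * (e + d)) / 2) * (∫ x : ℝ, ‖u x t‖ ^ 4)
        + (3 * b * c - a * (d + e)) *
            (∫ x : ℝ, u x t * deriv (fun y => (starRingEnd ℂ) (u y t)) x).im : ℝ) : ℂ) =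
      ∫ x, ((3 * b * e : ℂ) * (U 1 x t * V 1 x t)
        + (-(e * (e + d)) / 2 : ℂ) * (U 0 x t * V 0 x t * (U 0 x t * V 0 x t))
        + (3 * b * c - a * (d + e) : ℂ) *
          ((-(I / 2)) * (U 0 x t * V 1 x t - V 0 x t * U 1 x t))) := by
    have d1 := ((hUd 1).mul (hVd 1)).const_mul (3 * b * e : ℂ)
    have d2 := (((hUd 0).mul (hVd 0)).mul ((hUd 0).mul (hVd 0))).const_mul
      (-(e * (e + d)) / 2 : ℂ)
    have d3 := ((((hUd 0).mul (hVd 1)).sub ((hVd 0).mul (hUd 1))).const_mul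
      (-(I / 2))).const_mul (3 * b * c - a * (d + e) : ℂ)
    have him : (∫ x, U 0 x t * V 1 x t).im = ∫ x, (U 0 x t * V 1 x t).im :=
      (integral_im (((hUd 0).mul (hVd 1)).integrable t)).symm
    rw [integral_add ((d1.add d2).integrable t) (d3.integrable t),
      integral_add (d1.integrable t) (d2.integrable t), integral_const_mul, integral_const_mul,
      integral_const_mul]
    simp only [← hU1, ← hV1]
    simp only [← hU0]
    rw [him]
    push_cast
    simp only [← integral_complex_ofReal]
    congr! 5 with x x x
    · simp [hV, Complex.mul_conj']
    · simp only [hV, Complex.mul_conj']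
      push_cast
      ring
    · rw [Complex.im_eq_sub_conj]
      simp only [hV, map_mul, Complex.conj_conj]
      field_simp
      rw [Complex.I_sq]
      ring
  intro t
  exact_mod_cast (henergy t).trans ((hconst t 0).trans (henergy 0).symm)
end
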